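/- arXiv:2603.01079 — 5 statements merged into one kernel-verified Lean document; each statement's English description precedes it below -/
import Mathlib

section
/- Let n ≥ 1 and let σ, τ be permutations of {1, ..., n}. For a permutation ρ, let V(ρ) = {w_0^ρ, ..., w_n^ρ} ⊆ ℝ^n be the vertex set of Δ_ρ, where w_j^ρ is the indicator vector of {ρ(n−j+1), ..., ρ(n)}. Then Δ_σ ∩ Δ_τ equals the convex hull of V(σ) ∩ V(τ); that is, any two order simplices intersect in the convex hull of their common vertices. -/
/-- The order simplex `Δ_σ = {x ∈ ℝ^n : 0 ≤ x_{σ(1)} ≤ x_{σ(2)} ≤ ⋯ ≤ x_{σ(n)} ≤ 1}`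
associated to a permutation `σ` of the coordinates. -/
def orderSimplex (n : ℕ) (σ : Equiv.Perm (Fin n)) : Set (Fin n → ℝ) :=
  {x | (∀ i, 0 ≤ x i ∧ x i ≤ 1) ∧ ∀ i j : Fin n, i ≤ j → x (σ i) ≤ x (σ j)}

/-- The `j`-th vertex of the order simplex `Δ_σ`: the indicator vector of the set
`{σ(n-j+1), …, σ(n)}` of the images of the top `j` positions (so `w_0 = 0` and
`w_n = (1,…,1)`). -/
def orderSimplexVertex (n : ℕ) (σ : Equiv.Perm (Fin n)) (j : Fin (n + 1)) : Fin n → ℝ :=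
  fun i => if n - (j : ℕ) ≤ ((σ.symm i : Fin n) : ℕ) then 1 else 0

theorem convex_orderSimplex (n : ℕ) (σ : Equiv.Perm (Fin n)) : Convex ℝ (orderSimplex n σ) := by
  intro x hx y hy a b ha hb hab
  refine ⟨fun i => ?_, fun i j hij => ?_⟩
  · have h₀ := mul_nonneg ha (hx.1 i).1
    have h₁ := mul_nonneg hb (hy.1 i).1
    have h₂ := mul_le_mul_of_nonneg_left (hx.1 i).2 ha
    have h₃ := mul_le_mul_of_nonneg_left (hy.1 i).2 hb
    simp only [Pi.add_apply, Pi.smul_apply, smul_eq_mul]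
    constructor <;> linarith
  · have h₀ := mul_le_mul_of_nonneg_left (hx.2 i j hij) ha
    have h₁ := mul_le_mul_of_nonneg_left (hy.2 i j hij) hb
    simp only [Pi.add_apply, Pi.smul_apply, smul_eq_mul]
    linarith

theorem orderSimplexVertex_mem_orderSimplex (n : ℕ) (σ : Equiv.Perm (Fin n)) (j : Fin (n + 1)) :
    orderSimplexVertex n σ j ∈ orderSimplex n σ := by
  refine ⟨fun i => ?_, fun i k hik => ?_⟩
  · unfold orderSimplexVertex
    split_ifs <;> norm_num
  · have : (i : ℕ) ≤ k := hik
    simp only [orderSimplexVertex, Equiv.symm_apply_apply]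
    split_ifs <;> first | omega | norm_num

/-- The indicator vector of a superlevel set of a point of `Δ_σ` is a vertex of `Δ_σ`. -/
theorem superlevel_indicator_mem_range_orderSimplexVertex {n : ℕ} {σ : Equiv.Perm (Fin n)}
    {x : Fin n → ℝ} (hx : x ∈ orderSimplex n σ) (t : ℝ) :
    (fun i => if t ≤ x i then (1 : ℝ) else 0) ∈ Set.range (orderSimplexVertex n σ) := by
  classical
  have hex : ∃ k : ℕ, ∀ h : k < n, t ≤ x (σ ⟨k, h⟩) := ⟨n, fun h => absurd h (lt_irrefl n)⟩
  have hle : Nat.find hex ≤ n := Nat.find_min' hex fun h => absurd h (lt_irrefl n)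
  refine ⟨⟨n - Nat.find hex, by omega⟩, funext fun i => ?_⟩
  have hiff : n - (n - Nat.find hex) ≤ (σ.symm i : ℕ) ↔ t ≤ x i := by
    rw [Nat.sub_sub_self hle]
    constructor
    · intro h
      have hlt : Nat.find hex < n := h.trans_lt (σ.symm i).isLt
      have hmono := hx.2 ⟨Nat.find hex, hlt⟩ (σ.symm i) h
      rw [Equiv.apply_symm_apply] at hmono
      exact (Nat.find_spec hex hlt).trans hmono
    · intro h
      exact Nat.find_min' hex fun _ => by simpa using h
  simp only [orderSimplexVertex, hiff]

/-- Layer-cake formula for a value of a monotone sequence. -/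
theorem sum_sub_mul_indicator_le_of_monotone {y : ℕ → ℝ} (hy : Monotone y) {N j : ℕ}
    (hj : j ≤ N) :
    ∑ k ∈ Finset.range N, (y (k + 1) - y k) * (if y (k + 1) ≤ y j then 1 else 0) =
      y j - y 0 := by
  have hterm : ∀ k, (y (k + 1) - y k) * (if y (k + 1) ≤ y j then 1 else 0) =
      min (y (k + 1)) (y j) - min (y k) (y j) := by
    intro k
    split_ifs with h
    · rw [min_eq_left h, min_eq_left ((hy k.le_succ).trans h), mul_one]
    · have hjk : j ≤ k := by
        by_contra! hlt
        exact h (hy hlt)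
      rw [min_eq_right (not_le.mp h).le, min_eq_right (hy hjk), mul_zero, sub_self]
  simp only [hterm]
  rw [Finset.sum_range_sub fun k => min (y k) (y j), min_eq_right (hy hj),
    min_eq_left (hy j.zero_le)]

/-- A point whose coordinates are values of a monotone sequence running from `0` to `1` is a convex
combination of the indicator vectors of its superlevel sets. -/
theorem mem_convexHull_of_superlevel_indicator_mem {ι : Type*} {S : Set (ι → ℝ)} {x : ι → ℝ}
    (hS : ∀ t : ℝ, (fun i => if t ≤ x i then (1 : ℝ) else 0) ∈ S) {y : ℕ → ℝ} (hy : Monotone y)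
    {N : ℕ} (h₀ : y 0 = 0) (h₁ : y N = 1) (hxy : ∀ i, ∃ j ≤ N, x i = y j) :
    x ∈ convexHull ℝ S := by
  have hsum : x = ∑ k ∈ Finset.range N,
      (y (k + 1) - y k) • (fun i => if y (k + 1) ≤ x i then (1 : ℝ) else 0) := by
    funext i
    obtain ⟨j, hj, hij⟩ := hxy i
    simp only [Finset.sum_apply, Pi.smul_apply, smul_eq_mul, hij]
    rw [sum_sub_mul_indicator_le_of_monotone hy hj, h₀, sub_zero]
  rw [hsum]
  refine (convex_convexHull ℝ S).sum_mem (fun k _ => sub_nonneg.2 (hy k.le_succ)) ?_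
    fun k _ => subset_convexHull ℝ S (hS _)
  rw [Finset.sum_range_sub, h₀, h₁, sub_zero]

theorem exists_monotone_seq_of_mem_orderSimplex {n : ℕ} {σ : Equiv.Perm (Fin n)} {x : Fin n → ℝ}
    (hx : x ∈ orderSimplex n σ) :
    ∃ y : ℕ → ℝ, Monotone y ∧ y 0 = 0 ∧ y (n + 1) = 1 ∧ ∀ i, ∃ j ≤ n + 1, x i = y j := by
  let z : ℕ → ℝ := fun k => if h : k < n then x (σ ⟨k, h⟩) else 1
  refine ⟨fun k => Nat.casesOn k 0 z, monotone_nat_of_le_succ fun k => ?_, rfl, by simp [z],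
    fun i => ⟨σ.symm i + 1, by omega, by simp [z]⟩⟩
  cases k with
  | zero =>
    simp only [z]
    split_ifs
    exacts [(hx.1 _).1, zero_le_one]
  | succ k =>
    simp only [z]
    split_ifs
    · exact hx.2 _ _ (Fin.mk_le_mk.2 k.le_succ)
    · exact (hx.1 _).2
    · omega
    · exact le_rfl

theorem orderSimplex_inter_eq_convexHull_common_vertices (n : ℕ) (hn : 1 ≤ n)
    (σ τ : Equiv.Perm (Fin n)) :
    orderSimplex n σ ∩ orderSimplex n τ =
      convexHull ℝ (Set.range (orderSimplexVertex n σ) ∩ Set.range (orderSimplexVertex n τ)) := by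
  apply Set.Subset.antisymm
  · rintro x ⟨hσ, hτ⟩
    obtain ⟨y, hy, h₀, h₁, hxy⟩ := exists_monotone_seq_of_mem_orderSimplex hσ
    exact mem_convexHull_of_superlevel_indicator_mem
      (fun t => ⟨superlevel_indicator_mem_range_orderSimplexVertex hσ t,
        superlevel_indicator_mem_range_orderSimplexVertex hτ t⟩) hy h₀ h₁ hxy
  · refine convexHull_min ?_ ((convex_orderSimplex n σ).inter (convex_orderSimplex n τ))
    exact Set.inter_subset_inter
      (Set.range_subset_iff.2 (orderSimplexVertex_mem_orderSimplex n σ))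
      (Set.range_subset_iff.2 (orderSimplexVertex_mem_orderSimplex n τ))
end

section
/- Let n ≥ 1, let S_0 and S_1 be disjoint subsets of {1, ..., n}, and let F = {x ∈ [0,1]^n : x_i = 0 for all i ∈ S_0 and x_i = 1 for all i ∈ S_1} be the corresponding face of the cube. Then for every permutation σ of {1, ..., n}, the intersection Δ_σ ∩ F equals the convex hull of those vertices of Δ_σ that lie in F (where the vertices of Δ_σ are the indicator vectors w_j of the sets {σ(n−j+1), ..., σ(n)}, j = 0, ..., n). -/
/-- The increasing sequence `0, x_{σ(1)}, …, x_{σ(n)}, 1, 1, …`. -/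
def sortedCoords (n : ℕ) (σ : Equiv.Perm (Fin n)) (x : Fin n → ℝ) : ℕ → ℝ
  | 0 => 0
  | k + 1 => if h : k < n then x (σ ⟨k, h⟩) else 1

theorem sortedCoords_symm_succ {n : ℕ} (σ : Equiv.Perm (Fin n)) (x : Fin n → ℝ) (i : Fin n) :
    sortedCoords n σ x ((σ.symm i : ℕ) + 1) = x i := by
  simp [sortedCoords]

theorem monotone_sortedCoords {n : ℕ} {σ : Equiv.Perm (Fin n)} {x : Fin n → ℝ}
    (hx : x ∈ orderSimplex n σ) : Monotone (sortedCoords n σ x) := by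
  obtain ⟨hb, hm⟩ := hx
  refine monotone_nat_of_le_succ fun k => ?_
  cases k with
  | zero =>
    simp only [sortedCoords]
    split_ifs
    · exact (hb _).1
    · exact zero_le_one
  | succ k =>
    simp only [sortedCoords]
    split_ifs
    · exact hm _ _ (by simp)
    · exact (hb _).2
    · omega
    · exact le_rfl

theorem convex_cubeFace {ι : Type*} (S₀ S₁ : Set ι) :
    Convex ℝ {x : ι → ℝ | (∀ i, x i ∈ Set.Icc (0 : ℝ) 1) ∧
      (∀ i ∈ S₀, x i = 0) ∧ ∀ i ∈ S₁, x i = 1} := by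
  rintro x ⟨hx, hx₀, hx₁⟩ y ⟨hy, hy₀, hy₁⟩ a b ha hb hab
  refine ⟨fun i => convex_Icc (0 : ℝ) 1 (hx i) (hy i) ha hb hab, fun i hi => ?_, fun i hi => ?_⟩
  · simp [hx₀ i hi, hy₀ i hi]
  · simp [hx₁ i hi, hy₁ i hi, hab]

/-- The barycentric coordinates of a point of the order simplex are the successive differences of
its sorted coordinates. -/
theorem sum_sortedCoords_sub_smul_orderSimplexVertex {n : ℕ} (σ : Equiv.Perm (Fin n))
    (x : Fin n → ℝ) :
    ∑ k ∈ Finset.range (n + 1), (sortedCoords n σ x (k + 1) - sortedCoords n σ x k) •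
      orderSimplexVertex n σ (Fin.ofNat (n + 1) (n - k)) = x := by
  ext i
  have hi := (σ.symm i).isLt
  have hsub : Finset.range ((σ.symm i : ℕ) + 1) ⊆ Finset.range (n + 1) :=
    Finset.range_subset_range.2 (by omega)
  rw [Finset.sum_apply, ← Finset.sum_subset hsub]
  · rw [← sortedCoords_symm_succ σ x i, ← sub_zero (sortedCoords n σ x _)]
    refine Eq.trans (Finset.sum_congr rfl fun k hk => ?_) (Finset.sum_range_sub _ _)
    rw [Finset.mem_range] at hk
    have hval : (Fin.ofNat (n + 1) (n - k) : ℕ) = n - k := Nat.mod_eq_of_lt (by omega)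
    rw [Pi.smul_apply, orderSimplexVertex, if_pos (by omega), smul_eq_mul, mul_one]
  · intro k hk hk'
    rw [Finset.mem_range] at hk hk'
    have hval : (Fin.ofNat (n + 1) (n - k) : ℕ) = n - k := Nat.mod_eq_of_lt (by omega)
    rw [Pi.smul_apply, orderSimplexVertex, if_neg (by omega), smul_zero]


theorem orderSimplex_inter_cubeFace (n : ℕ) (hn : 1 ≤ n)
    (S₀ S₁ : Set (Fin n)) (hdisj : Disjoint S₀ S₁) (σ : Equiv.Perm (Fin n)) :
    orderSimplex n σ ∩
        {x : Fin n → ℝ | (∀ i, x i ∈ Set.Icc (0 : ℝ) 1) ∧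
          (∀ i ∈ S₀, x i = 0) ∧ ∀ i ∈ S₁, x i = 1} =
      convexHull ℝ (Set.range (orderSimplexVertex n σ) ∩
        {x : Fin n → ℝ | (∀ i, x i ∈ Set.Icc (0 : ℝ) 1) ∧
          (∀ i ∈ S₀, x i = 0) ∧ ∀ i ∈ S₁, x i = 1}) := by
  refine Set.Subset.antisymm ?_ (convexHull_min ?_ ?_)
  · rintro x ⟨hx, -, hx₀, hx₁⟩
    have hmono := monotone_sortedCoords hx
    rw [← sum_sortedCoords_sub_smul_orderSimplexVertex σ x]
    rw [← Finset.sum_filter_of_ne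
      (p := fun k => sortedCoords n σ x (k + 1) - sortedCoords n σ x k ≠ 0)
      fun k _ h h0 => h (by rw [h0, zero_smul])]
    refine (convex_convexHull ℝ _).sum_mem (fun k _ => sub_nonneg.2 (hmono k.le_succ)) ?_
      fun k hk => subset_convexHull ℝ _ ⟨⟨_, rfl⟩,
        (orderSimplexVertex_mem_orderSimplex n σ _).1, fun i hi => ?_, fun i hi => ?_⟩
    · rw [Finset.sum_filter_ne_zero, Finset.sum_range_sub]
      simp [sortedCoords]
    all_goals
      obtain ⟨hkn, hne⟩ := Finset.mem_filter.1 hk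
      rw [Finset.mem_range] at hkn
      have hval : (Fin.ofNat (n + 1) (n - k) : ℕ) = n - k := Nat.mod_eq_of_lt (by omega)
      have hlt : sortedCoords n σ x k < sortedCoords n σ x (k + 1) :=
        (hmono k.le_succ).lt_of_ne (sub_ne_zero.1 hne).symm
      have hxi := sortedCoords_symm_succ σ x i
    · refine if_neg fun h => ?_
      have h1 := hmono (show k + 1 ≤ (σ.symm i : ℕ) + 1 by omega)
      have h2 := hmono k.zero_le
      have h3 : sortedCoords n σ x 0 = 0 := rfl
      linarith [hx₀ i hi]
    · refine if_pos (not_lt.1 fun h => ?_)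
      have h1 := hmono (show (σ.symm i : ℕ) + 1 ≤ k by omega)
      have h2 := hmono (show k + 1 ≤ n + 1 by omega)
      have h3 : sortedCoords n σ x (n + 1) = 1 := by simp [sortedCoords]
      linarith [hx₁ i hi]
  · rintro _ ⟨⟨j, rfl⟩, hF⟩
    exact ⟨orderSimplexVertex_mem_orderSimplex n σ j, hF⟩
  · exact (convex_orderSimplex n σ).inter (convex_cubeFace S₀ S₁)
end

section
/- Let k, m ≥ 0 be integers and let P and Q be two monotone lattice paths from (0,0) to (k,m), regarded as the sets of lattice points they visit. Then σ_P ∩ σ_Q = conv{(e_i, f_j) : (i,j) ∈ P ∩ Q}; that is, two staircase simplices intersect exactly in the convex hull of the points associated to the lattice points common to both paths. -/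
/-- A monotone lattice path from `(0,0)` to `(k,m)`: a sequence of `k+m+1` lattice
points starting at `(0,0)`, ending at `(k,m)`, in which each step increases exactly
one of the two coordinates by `1`. -/
structure MonotoneLatticePath (k m : ℕ) where
  pts : Fin (k + m + 1) → Fin (k + 1) × Fin (m + 1)
  start_eq : pts 0 = (0, 0)
  finish_eq : pts (Fin.last (k + m)) = (Fin.last k, Fin.last m)
  step : ∀ t : Fin (k + m),
    (((pts t.succ).1 : ℕ) = ((pts t.castSucc).1 : ℕ) + 1 ∧
        (pts t.succ).2 = (pts t.castSucc).2) ∨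
    (((pts t.succ).2 : ℕ) = ((pts t.castSucc).2 : ℕ) + 1 ∧
        (pts t.succ).1 = (pts t.castSucc).1)

/-- The `a`-th standard basis vector of `ℝ^{k+1}`. -/
def stdVert (k : ℕ) (a : Fin (k + 1)) : Fin (k + 1) → ℝ :=
  fun b => if b = a then 1 else 0

/-- The point `v_t = (e_{i_t}, f_{j_t})` of the staircase simplex associated to the
lattice point `(i_t, j_t)` of a monotone lattice path. -/
def pathPoint {k m : ℕ} (P : MonotoneLatticePath k m) (t : Fin (k + m + 1)) :
    (Fin (k + 1) → ℝ) × (Fin (m + 1) → ℝ) :=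
  (stdVert k (P.pts t).1, stdVert m (P.pts t).2)

/-- The staircase simplex `σ_P = conv{v_0, …, v_{k+m}}` of a monotone lattice path. -/
def staircaseSimplex {k m : ℕ} (P : MonotoneLatticePath k m) :
    Set ((Fin (k + 1) → ℝ) × (Fin (m + 1) → ℝ)) :=
  convexHull ℝ (Set.range (pathPoint P))

open Finset in
/-- A function on a finite partial order is determined by its sums over lower sets `Iic p`. -/
lemma eq_of_forall_sum_Iic_eq {α : Type*} [PartialOrder α] [Fintype α] [LocallyFiniteOrderBot α]
    {u w : α → ℝ} (h : ∀ p, ∑ q ∈ Iic p, u q = ∑ q ∈ Iic p, w q) : u = w := by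
  classical
  funext p
  induction p using WellFoundedLT.induction with
  | ind p ih =>
    have hp := h p
    have hlt : ∑ q ∈ Iio p, u q = ∑ q ∈ Iio p, w q :=
      sum_congr rfl fun q hq => ih q (mem_Iio.mp hq)
    rw [← Iio_insert, sum_insert (by simp), sum_insert (by simp), hlt] at hp
    exact add_right_cancel hp

open Finset in
/-- The cumulative sums of a nonnegative function supported on a chain of a product of two
finite linear orders are the minima of the cumulative sums of its marginals. -/
lemma sum_Iic_eq_min_of_isChain {α β : Type*} [LinearOrder α] [LinearOrder β] [Fintype α]
    [Fintype β] [LocallyFiniteOrderBot α] [LocallyFiniteOrderBot β] {S : Set (α × β)}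
    (hS : IsChain (· ≤ ·) S) {w : α × β → ℝ} (hw : ∀ p, 0 ≤ w p) (hwS : ∀ p ∉ S, w p = 0)
    (p : α × β) :
    ∑ q ∈ Iic p, w q = min (∑ q with q.1 ≤ p.1, w q) (∑ q with q.2 ≤ p.2, w q) := by
  have hsub₁ : Iic p ⊆ ({q | q.1 ≤ p.1} : Finset (α × β)) := fun q hq => by
    simpa using (mem_Iic.mp hq).1
  have hsub₂ : Iic p ⊆ ({q | q.2 ≤ p.2} : Finset (α × β)) := fun q hq => by
    simpa using (mem_Iic.mp hq).2
  have hle : ∑ q ∈ Iic p, w q ≤ min (∑ q with q.1 ≤ p.1, w q) (∑ q with q.2 ≤ p.2, w q) :=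
    le_min (sum_le_sum_of_subset_of_nonneg hsub₁ fun q _ _ => hw q)
      (sum_le_sum_of_subset_of_nonneg hsub₂ fun q _ _ => hw q)
  refine le_antisymm hle ?_
  by_cases h : ∃ r ∈ S, r.1 ≤ p.1 ∧ p.2 < r.2
  · obtain ⟨r, hr, hr₁, hr₂⟩ := h
    refine (min_le_right _ _).trans (sum_subset hsub₂ fun q hq hqp => hwS q fun hqS => ?_).ge
    have hq₂ : q.2 ≤ p.2 := by simpa using hq
    have hq₁ : p.1 < q.1 := lt_of_not_ge fun h => hqp (mem_Iic.mpr ⟨h, hq₂⟩)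
    rcases hS.total hqS hr with h | h
    · exact (hq₁.trans_le (h.1.trans hr₁)).false
    · exact (hr₂.trans_le (h.2.trans hq₂)).false
  · refine (min_le_left _ _).trans (sum_subset hsub₁ fun q hq hqp => hwS q fun hqS => ?_).ge
    have hq₁ : q.1 ≤ p.1 := by simpa using hq
    exact h ⟨q, hqS, hq₁, lt_of_not_ge fun h => hqp (mem_Iic.mpr ⟨hq₁, h⟩)⟩

/-- Points of the convex hull of an image, as convex combinations with weights indexed by the
whole finite type and vanishing outside the given set. -/
lemma mem_convexHull_image_iff_exists_weights {ι E : Type*} [Fintype ι] [AddCommGroup E]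
    [Module ℝ E] (f : ι → E) (S : Set ι) (x : E) :
    x ∈ convexHull ℝ (f '' S) ↔
      ∃ w : ι → ℝ, (∀ i, 0 ≤ w i) ∧ (∀ i ∉ S, w i = 0) ∧ ∑ i, w i = 1 ∧ ∑ i, w i • f i = x := by
  classical
  constructor
  · intro hx
    refine convexHull_min (t := {x | ∃ w : ι → ℝ, (∀ i, 0 ≤ w i) ∧ (∀ i ∉ S, w i = 0) ∧
      ∑ i, w i = 1 ∧ ∑ i, w i • f i = x}) ?_ ?_ hx
    · rintro _ ⟨i, hi, rfl⟩
      refine ⟨Pi.single i 1, fun j => ?_, fun j hj => ?_, by simp, by simp [Pi.single_apply]⟩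
      · rw [Pi.single_apply]
        split_ifs <;> norm_num
      · exact Pi.single_eq_of_ne (fun h => hj (by rwa [h])) _
    · rintro _ ⟨u, hu, huS, hu1, rfl⟩ _ ⟨v, hv, hvS, hv1, rfl⟩ a b ha hb hab
      refine ⟨fun i => a * u i + b * v i, fun i => ?_, fun i hi => ?_, ?_, ?_⟩
      · exact add_nonneg (mul_nonneg ha (hu i)) (mul_nonneg hb (hv i))
      · simp [huS i hi, hvS i hi]
      · rw [Finset.sum_add_distrib, ← Finset.mul_sum, ← Finset.mul_sum, hu1, hv1, mul_one,
          mul_one, hab]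
      · simp only [add_smul, mul_smul, Finset.sum_add_distrib, Finset.smul_sum]
  · rintro ⟨w, hw, hwS, hw1, rfl⟩
    have hsupp : ∀ i, w i ≠ 0 → i ∈ S := fun i hi => by_contra fun h => hi (hwS i h)
    rw [← Finset.sum_filter_of_ne (p := (· ∈ S)) fun i _ h => hsupp i fun h0 => h (by simp [h0])]
    rw [← Finset.sum_filter_of_ne (p := (· ∈ S)) fun i _ h => hsupp i h] at hw1
    exact (convex_convexHull ℝ _).sum_mem (fun i _ => hw i) hw1 fun i hi =>
      subset_convexHull ℝ _ ⟨i, (Finset.mem_filter.mp hi).2, rfl⟩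

/-- The point `(e_i, f_j)` associated to the lattice point `(i, j)`. -/
def latticeVert (k m : ℕ) (p : Fin (k + 1) × Fin (m + 1)) :
    (Fin (k + 1) → ℝ) × (Fin (m + 1) → ℝ) :=
  (stdVert k p.1, stdVert m p.2)

lemma sum_Iic_stdVert (k : ℕ) (a i : Fin (k + 1)) :
    ∑ b ∈ Finset.Iic i, stdVert k a b = if a ≤ i then 1 else 0 := by
  simp [stdVert]

lemma sum_filter_fst_le_eq {k m : ℕ} (w : Fin (k + 1) × Fin (m + 1) → ℝ) (i : Fin (k + 1)) :
    ∑ q with q.1 ≤ i, w q = ∑ a ∈ Finset.Iic i, (∑ q, w q • latticeVert k m q).1 a := by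
  simp only [Prod.fst_sum, Finset.sum_apply, latticeVert, Prod.smul_fst, Pi.smul_apply,
    smul_eq_mul]
  rw [Finset.sum_comm]
  simp [← Finset.mul_sum, sum_Iic_stdVert, Finset.sum_filter]

lemma sum_filter_snd_le_eq {k m : ℕ} (w : Fin (k + 1) × Fin (m + 1) → ℝ) (j : Fin (m + 1)) :
    ∑ q with q.2 ≤ j, w q = ∑ b ∈ Finset.Iic j, (∑ q, w q • latticeVert k m q).2 b := by
  simp only [Prod.snd_sum, Finset.sum_apply, latticeVert, Prod.smul_snd, Pi.smul_apply,
    smul_eq_mul]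
  rw [Finset.sum_comm]
  simp [← Finset.mul_sum, sum_Iic_stdVert, Finset.sum_filter]

/-- Nonnegative weights supported on a chain are determined by the point they represent. -/
lemma weights_eq_of_isChain {k m : ℕ} {S T : Set (Fin (k + 1) × Fin (m + 1))}
    (hS : IsChain (· ≤ ·) S) (hT : IsChain (· ≤ ·) T) {u w : Fin (k + 1) × Fin (m + 1) → ℝ}
    (hu : ∀ p, 0 ≤ u p) (hw : ∀ p, 0 ≤ w p) (huS : ∀ p ∉ S, u p = 0) (hwT : ∀ p ∉ T, w p = 0)
    (h : ∑ p, u p • latticeVert k m p = ∑ p, w p • latticeVert k m p) : u = w :=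
  eq_of_forall_sum_Iic_eq fun p => by
    rw [sum_Iic_eq_min_of_isChain hS hu huS, sum_Iic_eq_min_of_isChain hT hw hwT,
      sum_filter_fst_le_eq, sum_filter_fst_le_eq, sum_filter_snd_le_eq, sum_filter_snd_le_eq, h]

lemma convexHull_image_inter_of_isChain {k m : ℕ} {S T : Set (Fin (k + 1) × Fin (m + 1))}
    (hS : IsChain (· ≤ ·) S) (hT : IsChain (· ≤ ·) T) :
    convexHull ℝ (latticeVert k m '' S) ∩ convexHull ℝ (latticeVert k m '' T) =
      convexHull ℝ (latticeVert k m '' (S ∩ T)) := by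
  refine Set.Subset.antisymm ?_ (Set.subset_inter
    (convexHull_mono (Set.image_mono Set.inter_subset_left))
    (convexHull_mono (Set.image_mono Set.inter_subset_right)))
  rintro x ⟨hxS, hxT⟩
  obtain ⟨u, hu, huS, hu1, hux⟩ := (mem_convexHull_image_iff_exists_weights _ _ _).mp hxS
  obtain ⟨w, hw, hwT, -, hwx⟩ := (mem_convexHull_image_iff_exists_weights _ _ _).mp hxT
  have huw : u = w := weights_eq_of_isChain hS hT hu hw huS hwT (hux.trans hwx.symm)
  refine (mem_convexHull_image_iff_exists_weights _ _ _).mpr ⟨u, hu, fun p hp => ?_, hu1, hux⟩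
  by_cases hpS : p ∈ S
  · rw [huw]
    exact hwT p fun hpT => hp ⟨hpS, hpT⟩
  · exact huS p hpS

namespace MonotoneLatticePath

variable {k m : ℕ}

lemma monotone_pts (P : MonotoneLatticePath k m) : Monotone P.pts :=
  Fin.monotone_iff_le_succ.mpr fun t => by
    rcases P.step t with ⟨h₁, h₂⟩ | ⟨h₂, h₁⟩
    · exact ⟨Fin.le_def.mpr (by omega), h₂.ge⟩
    · exact ⟨h₁.ge, Fin.le_def.mpr (by omega)⟩

lemma isChain_range_pts (P : MonotoneLatticePath k m) : IsChain (· ≤ ·) (Set.range P.pts) :=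
  P.monotone_pts.isChain_range

lemma staircaseSimplex_eq (P : MonotoneLatticePath k m) :
    staircaseSimplex P = convexHull ℝ (latticeVert k m '' Set.range P.pts) := by
  rw [← Set.range_comp]
  rfl

end MonotoneLatticePath

theorem staircaseSimplex_inter_eq_convexHull_common (k m : ℕ)
    (P Q : MonotoneLatticePath k m) :
    staircaseSimplex P ∩ staircaseSimplex Q =
      convexHull ℝ {v : (Fin (k + 1) → ℝ) × (Fin (m + 1) → ℝ) |
        ∃ p : Fin (k + 1) × Fin (m + 1), (∃ t, P.pts t = p) ∧ (∃ s, Q.pts s = p) ∧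
          v = (stdVert k p.1, stdVert m p.2)} := by
  rw [P.staircaseSimplex_eq, Q.staircaseSimplex_eq,
    convexHull_image_inter_of_isChain P.isChain_range_pts Q.isChain_range_pts]
  congr 1
  ext v
  constructor
  · rintro ⟨p, ⟨hP, hQ⟩, rfl⟩
    exact ⟨p, hP, hQ, rfl⟩
  · rintro ⟨p, hP, hQ, rfl⟩
    exact ⟨p, ⟨hP, hQ⟩, rfl⟩
end

section
/- Let k, m ≥ 0 be integers, let A ⊆ {0, ..., k} and B ⊆ {0, ..., m} be nonempty subsets, and let F = conv{e_a : a ∈ A} × conv{f_b : b ∈ B} be the corresponding face of the product Δ^k × Δ^m. Then for every monotone lattice path P from (0,0) to (k,m), the intersection σ_P ∩ F equals the convex hull of {(e_{i_t}, f_{j_t}) : (i_t, j_t) ∈ A × B}, i.e., the convex hull of those vertices of σ_P that lie in F. -/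
/-- A linear functional that is nonnegative on `s` exposes a face of `convexHull ℝ s` spanned by
the points of `s` where it vanishes. -/
theorem mem_convexHull_inter_ker_of_nonneg {E : Type*} [AddCommGroup E] [Module ℝ E]
    (l : E →ₗ[ℝ] ℝ) {s : Set E} (hs : ∀ v ∈ s, 0 ≤ l v) {x : E}
    (hx : x ∈ convexHull ℝ s) (hlx : l x = 0) :
    x ∈ convexHull ℝ {v ∈ s | l v = 0} := by
  suffices h : convexHull ℝ s ⊆
      {x | 0 ≤ l x ∧ (l x = 0 → x ∈ convexHull ℝ {v ∈ s | l v = 0})} from (h hx).2 hlx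
  refine convexHull_min (fun v hv => ⟨hs v hv, fun h => subset_convexHull ℝ _ ⟨hv, h⟩⟩) ?_
  rintro x ⟨hx, hx'⟩ y ⟨hy, hy'⟩ a b ha hb hab
  have hl : l (a • x + b • y) = a * l x + b * l y := by simp
  have hax := mul_nonneg ha hx
  have hby := mul_nonneg hb hy
  refine ⟨hl ▸ add_nonneg hax hby, fun h => ?_⟩
  rw [hl] at h
  have hax0 : a * l x = 0 := by linarith
  have hby0 : b * l y = 0 := by linarith
  rcases mul_eq_zero.1 hax0 with rfl | hlx
  · obtain rfl : b = 1 := by linarith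
    simpa using hy' (by simpa using hby0)
  rcases mul_eq_zero.1 hby0 with rfl | hly
  · obtain rfl : a = 1 := by linarith
    simpa using hx' hlx
  exact convex_convexHull ℝ _ (hx' hlx) (hy' hly) ha hb hab

theorem eq_zero_of_mem_convexHull_stdVert {k : ℕ} {A : Set (Fin (k + 1))}
    {x : Fin (k + 1) → ℝ} (hx : x ∈ convexHull ℝ (stdVert k '' A))
    {a : Fin (k + 1)} (ha : a ∉ A) : x a = 0 := by
  suffices h : convexHull ℝ (stdVert k '' A) ⊆ {x | x a = 0} from h hx
  refine convexHull_min ?_ ?_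
  · rintro _ ⟨b, hb, rfl⟩
    exact if_neg fun h : a = b => ha (h ▸ hb)
  · intro x hx y hy s t _ _ _
    simp_all

open scoped Classical in
/-- The sum of the coordinates outside `A`. -/
noncomputable def outsideSum {k : ℕ} (A : Set (Fin (k + 1))) :
    (Fin (k + 1) → ℝ) →ₗ[ℝ] ℝ :=
  ∑ a with a ∉ A, LinearMap.proj a

open scoped Classical in
theorem outsideSum_stdVert {k : ℕ} (A : Set (Fin (k + 1))) (a : Fin (k + 1)) :
    outsideSum A (stdVert k a) = if a ∈ A then 0 else 1 := by
  simp [outsideSum, stdVert, LinearMap.sum_apply, ite_not]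

theorem outsideSum_eq_zero_of_mem_convexHull {k : ℕ} {A : Set (Fin (k + 1))}
    {x : Fin (k + 1) → ℝ} (hx : x ∈ convexHull ℝ (stdVert k '' A)) :
    outsideSum A x = 0 := by
  classical
  rw [outsideSum, LinearMap.sum_apply]
  exact Finset.sum_eq_zero fun a ha =>
    eq_zero_of_mem_convexHull_stdVert hx (Finset.mem_filter.1 ha).2

theorem staircaseSimplex_inter_face (k m : ℕ) (P : MonotoneLatticePath k m)
    (A : Set (Fin (k + 1))) (B : Set (Fin (m + 1))) (hA : A.Nonempty) (hB : B.Nonempty) :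
    staircaseSimplex P ∩
        ((convexHull ℝ (stdVert k '' A)) ×ˢ (convexHull ℝ (stdVert m '' B))) =
      convexHull ℝ {v : (Fin (k + 1) → ℝ) × (Fin (m + 1) → ℝ) |
        ∃ t, (P.pts t).1 ∈ A ∧ (P.pts t).2 ∈ B ∧ v = pathPoint P t} := by
  classical
  apply Set.Subset.antisymm
  · rintro x ⟨hx, hxA, hxB⟩
    have hl : ∀ t, ((outsideSum A).coprod (outsideSum B)) (pathPoint P t) =
        (if (P.pts t).1 ∈ A then 0 else 1) + (if (P.pts t).2 ∈ B then 0 else 1) := fun t => by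
      rw [LinearMap.coprod_apply, pathPoint, outsideSum_stdVert, outsideSum_stdVert]
    refine convexHull_mono ?_ (mem_convexHull_inter_ker_of_nonneg
      ((outsideSum A).coprod (outsideSum B)) ?_ hx ?_)
    · rintro _ ⟨⟨t, rfl⟩, ht⟩
      rw [hl] at ht
      refine ⟨t, ?_, ?_, rfl⟩
      · by_contra h
        rw [if_neg h] at ht
        split_ifs at ht <;> norm_num at ht
      · by_contra h
        rw [if_neg h] at ht
        split_ifs at ht <;> norm_num at ht
    · rintro _ ⟨t, rfl⟩
      rw [hl]
      split_ifs <;> norm_num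
    · rw [LinearMap.coprod_apply, outsideSum_eq_zero_of_mem_convexHull hxA,
        outsideSum_eq_zero_of_mem_convexHull hxB, add_zero]
  · refine convexHull_min ?_ ((convex_convexHull ℝ _).inter
      ((convex_convexHull ℝ _).prod (convex_convexHull ℝ _)))
    rintro _ ⟨t, hA, hB, rfl⟩
    exact ⟨subset_convexHull ℝ _ ⟨t, rfl⟩, subset_convexHull ℝ _ ⟨_, hA, rfl⟩,
      subset_convexHull ℝ _ ⟨_, hB, rfl⟩⟩
end

section
/- Let n ≥ 1 and let t : {1, ..., n+1} → ℝ^n be a tuple of points with ‖t(i)‖ = 1 for all i, which is antipodally generic, i.e., for every index subset J ⊆ {1, ..., n+1} with |J| = n, the origin 0 does not lie in the affine span of {t(j) : j ∈ J}. If 0 lies in the convex hull of {t(1), ..., t(n+1)}, then the points t(1), ..., t(n+1) are affinely independent and 0 lies in the interior of their convex hull. -/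
/-- A tuple of points on the unit sphere in `ℝ^n` (repetitions allowed) is
*antipodally generic* if for every index subset `J` with `|J| = n`, the origin does
not lie in the affine span of the corresponding points. -/
def AntipodallyGeneric {n N : ℕ} (p : Fin N → EuclideanSpace ℝ (Fin n)) : Prop :=
  ∀ J : Finset (Fin N), J.card = n →
    (0 : EuclideanSpace ℝ (Fin n)) ∉ affineSpan ℝ (p '' (J : Set (Fin N)))

open Finset in
theorem AntipodallyGeneric.weight_ne_zero {n : ℕ} {t : Fin (n + 1) → EuclideanSpace ℝ (Fin n)}
    (hgen : AntipodallyGeneric t) {w : Fin (n + 1) → ℝ} (hw : ∑ i, w i = 1)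
    (h0 : univ.affineCombination ℝ t w = 0) (k : Fin (n + 1)) : w k ≠ 0 := by
  intro hk
  refine hgen (univ.erase k) (by simp) ?_
  rw [← h0]
  refine affineCombination_mem_affineSpan_image hw (fun i _ hi ↦ ?_) t
  obtain rfl : i = k := by simpa using hi
  exact hk

open Finset in
theorem AntipodallyGeneric.affineIndependent {n : ℕ}
    {t : Fin (n + 1) → EuclideanSpace ℝ (Fin n)}
    (hgen : AntipodallyGeneric t) {w : Fin (n + 1) → ℝ} (hw : ∑ i, w i = 1)
    (h0 : univ.affineCombination ℝ t w = 0) : AffineIndependent ℝ t := by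
  rw [affineIndependent_iff_of_fintype]
  intro b hb hbt k
  by_contra hk
  refine hgen.weight_ne_zero (w := (-(w k / b k)) • b + w) ?_ ?_ k ?_
  · simp [sum_add_distrib, ← mul_sum, hb, hw]
  · rw [← weightedVSub_vadd_affineCombination, weightedVSub_const_smul, hbt, h0]
    simp
  · simp [hk]

theorem affineIndependent_and_interior_of_zero_mem_convexHull (n : ℕ) (hn : 1 ≤ n)
    (t : Fin (n + 1) → EuclideanSpace ℝ (Fin n)) (hnorm : ∀ i, ‖t i‖ = 1)
    (hgen : AntipodallyGeneric t)
    (hmem : (0 : EuclideanSpace ℝ (Fin n)) ∈ convexHull ℝ (Set.range t)) :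
    AffineIndependent ℝ t ∧
      (0 : EuclideanSpace ℝ (Fin n)) ∈ interior (convexHull ℝ (Set.range t)) := by
  obtain ⟨w, hw_nonneg, hw, h0⟩ : ∃ w : Fin (n + 1) → ℝ, (∀ i, 0 ≤ w i) ∧ ∑ i, w i = 1 ∧
      Finset.univ.affineCombination ℝ t w = 0 := by
    rw [convexHull_range_eq_exists_affineCombination] at hmem
    obtain ⟨s, w, hw_nonneg, hw, h0⟩ := hmem
    refine ⟨Set.indicator s w, fun i ↦ Set.indicator_nonneg hw_nonneg i, ?_, ?_⟩
    · rwa [Finset.sum_indicator_subset _ s.subset_univ]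
    · rwa [← Finset.affineCombination_indicator_subset _ _ s.subset_univ]
  have hind := hgen.affineIndependent hw h0
  have htop : affineSpan ℝ (Set.range t) = ⊤ := by
    rw [hind.affineSpan_eq_top_iff_card_eq_finrank_add_one]
    simp
  refine ⟨hind, ?_⟩
  let b : AffineBasis (Fin (n + 1)) ℝ (EuclideanSpace ℝ (Fin n)) := ⟨t, hind, htop⟩
  change 0 ∈ interior (convexHull ℝ (Set.range b))
  rw [b.interior_convexHull]
  intro i
  have hcoord : b.coord i 0 = w i := by
    rw [← h0]
    exact b.coord_apply_combination_of_mem (Finset.mem_univ i) hw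
  rw [hcoord]
  exact (hw_nonneg i).lt_of_ne' (hgen.weight_ne_zero hw h0 i)
end
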